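/- Frequency-domain input/initial-state-to-output formula (commutative case): suppose the input sequence u of a dissipative commutative Fornasini-Marchesini system lies in ℓ²_{U,ω}(ℤ₊^d). Then for every z ∈ 𝔹^d the Z-transforms satisfy x̂(z) = x(0) + (∑_k z_k A_k) x̂(z) + (∑_k z_k B_k) û(z) and ŷ(z) = C x̂(z) + D û(z); consequently ŷ(z) = F(z) û(z) + W(z) x(0), where F(z) = D + C(I − ∑_k z_k A_k)^{-1}(∑_k z_k B_k) and W(z) = C(I − ∑_k z_k A_k)^{-1}. -/

import Mathlib

open scoped BigOperators

/-- The weight `ω(n) = |n|!/n!`. -/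
noncomputable def wgt {d : ℕ} (n : Fin d → ℕ) : ℝ :=
  (Nat.factorial (∑ j, n j) : ℝ) / ∏ j, (Nat.factorial (n j) : ℝ)

open Finset in
lemma summable_of_levels {d : ℕ} {f : (Fin d → ℕ) → ℝ} {g : ℕ → ℝ} (hf : ∀ n, 0 ≤ f n)
    (hg : Summable g) (h : ∀ N, ∑ n ∈ piAntidiag (univ : Finset (Fin d)) N, f n ≤ g N) :
    Summable f := by
  have hg0 : ∀ N, 0 ≤ g N := fun N => (Finset.sum_nonneg fun n _ => hf n).trans (h N)
  refine summable_of_sum_le hf (c := ∑' N, g N) fun s => ?_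
  rw [← Finset.sum_fiberwise_of_maps_to (t := s.image fun n => ∑ j, n j)
    (g := fun n => ∑ j, n j) (fun n hn => Finset.mem_image_of_mem _ hn)]
  refine le_trans (Finset.sum_le_sum fun N _ => ?_) (hg.sum_le_tsum _ fun i _ => hg0 i)
  refine le_trans (Finset.sum_le_sum_of_subset_of_nonneg ?_ fun i _ _ => hf i) (h N)
  intro n hn
  simp only [Finset.mem_filter] at hn
  simp [Finset.mem_piAntidiag, hn.2]

lemma wgt_eq {d : ℕ} (n : Fin d → ℕ) : wgt n = (Nat.multinomial Finset.univ n : ℝ) := by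
  have h := Nat.multinomial_spec Finset.univ n
  have h2 : (∏ j, (Nat.factorial (n j) : ℝ)) ≠ 0 :=
    Finset.prod_ne_zero_iff.2 fun j _ => by positivity
  rw [wgt, div_eq_iff h2, ← h]
  push_cast
  ring

lemma one_le_wgt {d : ℕ} (n : Fin d → ℕ) : 1 ≤ wgt n := by
  rw [wgt_eq]
  exact_mod_cast Nat.multinomial_pos Finset.univ n

lemma sum_add_single {d : ℕ} (m : Fin d → ℕ) (j : Fin d) :
    ∑ i, (m + Pi.single j 1 : Fin d → ℕ) i = ∑ i, m i + 1 := by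
  simp [Finset.sum_add_distrib]

lemma wgt_add {d : ℕ} (m : Fin d → ℕ) (j : Fin d) :
    ((∑ i, m i : ℕ) + 1 : ℝ) * wgt m = (m j + 1) * wgt (m + Pi.single j 1) := by
  have h2 : ∀ m : Fin d → ℕ, (∏ j, (Nat.factorial (m j) : ℝ)) ≠ 0 := fun m =>
    Finset.prod_ne_zero_iff.2 fun j _ => by positivity
  have h3 : (∏ i, (Nat.factorial ((m + Pi.single j 1 : Fin d → ℕ) i) : ℝ))
      = (m j + 1) * ∏ i, (Nat.factorial (m i) : ℝ) := by
    rw [← Finset.mul_prod_erase _ _ (Finset.mem_univ j),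
      ← Finset.mul_prod_erase _ (fun i => (Nat.factorial (m i) : ℝ)) (Finset.mem_univ j)]
    have : ∏ i ∈ Finset.univ.erase j, (Nat.factorial ((m + Pi.single j 1 : Fin d → ℕ) i) : ℝ)
        = ∏ i ∈ Finset.univ.erase j, (Nat.factorial (m i) : ℝ) := by
      refine Finset.prod_congr rfl fun i hi => ?_
      simp [Pi.single_eq_of_ne (Finset.ne_of_mem_erase hi)]
    rw [this]
    simp [Nat.factorial_succ]
    ring
  have hm : ((m j : ℝ) + 1) ≠ 0 := by positivity
  rw [wgt, wgt, h3, sum_add_single, Nat.factorial_succ]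
  have := h2 m
  push_cast
  field_simp

open Finset in
lemma level_summable {d : ℕ} (z : Fin d → ℂ) (hz : ∑ j, ‖z j‖ ^ 2 < 1)
    (a : (Fin d → ℕ) → ℝ) (ha : ∀ n, 0 ≤ a n) (M : ℝ)
    (hM : ∀ N, ∑ n ∈ piAntidiag (univ : Finset (Fin d)) N, (wgt n)⁻¹ * a n ^ 2 ≤ M) :
    Summable fun n : Fin d → ℕ => ‖∏ j, z j ^ n j‖ * a n := by
  set r := ∑ j, ‖z j‖ ^ 2 with hr
  have hr0 : 0 ≤ r := Finset.sum_nonneg fun j _ => by positivity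
  have hs1 : √r < 1 := by
    rw [Real.sqrt_lt' one_pos]; simpa using hz
  refine summable_of_levels (fun n => mul_nonneg (norm_nonneg _) (ha n))
    (g := fun N => √r ^ N * √M)
    ((summable_geometric_of_lt_one (Real.sqrt_nonneg _) hs1).mul_right _) fun N => ?_
  have hw : ∀ n : Fin d → ℕ, 0 < wgt n := fun n => one_pos.trans_le (one_le_wgt n)
  have hM0 : 0 ≤ M := (Finset.sum_nonneg fun n _ =>
    mul_nonneg (inv_nonneg.2 (hw n).le) (sq_nonneg _)).trans (hM 0)
  have hcs := Finset.sum_sq_le_sum_mul_sum_of_sq_le_mul (piAntidiag (univ : Finset (Fin d)) N)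
    (r := fun n => ‖∏ j, z j ^ n j‖ * a n) (f := fun n => wgt n * ‖∏ j, z j ^ n j‖ ^ 2)
    (g := fun n => (wgt n)⁻¹ * a n ^ 2)
    (fun n _ => mul_nonneg (hw n).le (sq_nonneg _))
    (fun n _ => mul_nonneg (inv_nonneg.2 (hw n).le) (sq_nonneg _))
    (fun n _ => by have := (hw n).ne'; apply le_of_eq; field_simp)
  have hmul : ∑ n ∈ piAntidiag (univ : Finset (Fin d)) N, wgt n * ‖∏ j, z j ^ n j‖ ^ 2 = r ^ N := by
    rw [hr, Finset.sum_pow_eq_sum_piAntidiag]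
    refine Finset.sum_congr rfl fun n _ => ?_
    rw [wgt_eq, norm_prod, ← Finset.prod_pow]
    congr 1
    refine Finset.prod_congr rfl fun j _ => ?_
    rw [norm_pow]; ring
  rw [hmul] at hcs
  have h4 : (∑ n ∈ piAntidiag (univ : Finset (Fin d)) N, ‖∏ j, z j ^ n j‖ * a n) ^ 2
      ≤ (√r ^ N * √M) ^ 2 := by
    refine hcs.trans ?_
    rw [mul_pow, ← pow_mul, mul_comm N 2, pow_mul, Real.sq_sqrt hr0, Real.sq_sqrt hM0]
    exact mul_le_mul_of_nonneg_left (hM N) (by positivity)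
  exact le_of_sq_le_sq h4 (by positivity)

lemma sub_add_single {d : ℕ} {n : Fin d → ℕ} {j : Fin d} (h : n j ≠ 0) :
    (n - Pi.single j 1) + Pi.single j 1 = n := by
  funext i
  by_cases hi : i = j
  · subst hi; simp; omega
  · simp [hi]

/-- the recursion on levels -/
lemma level_step {d : ℕ} {X : Type*} [NormedAddCommGroup X]
    (x : (Fin d → ℕ) → X) (g : Fin d → (Fin d → ℕ) → X) (x0 : X) (e : (Fin d → ℕ) → ℝ)
    (hg : ∀ m, ∑ j, ‖g j m‖ ^ 2 ≤ e m)
    (hx : ∀ n, x n = (if n = 0 then x0 else 0)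
      + ∑ j, if n j = 0 then 0 else g j (n - Pi.single j 1)) (N : ℕ) :
    ∑ n ∈ Finset.piAntidiag (Finset.univ : Finset (Fin d)) (N + 1), (wgt n)⁻¹ * ‖x n‖ ^ 2
      ≤ ∑ n ∈ Finset.piAntidiag (Finset.univ : Finset (Fin d)) N, (wgt n)⁻¹ * e n := by
  have hw : ∀ n : Fin d → ℕ, 0 < wgt n := fun n => one_pos.trans_le (one_le_wgt n)
  have h1 : ∀ n ∈ Finset.piAntidiag (Finset.univ : Finset (Fin d)) (N + 1),
      (wgt n)⁻¹ * ‖x n‖ ^ 2 ≤ ∑ j, if n j = 0 then 0 else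
        (wgt (n - Pi.single j 1))⁻¹ * ‖g j (n - Pi.single j 1)‖ ^ 2 := by
    intro n hn
    have hs : ∑ j, n j = N + 1 := (Finset.mem_piAntidiag.1 hn).1
    have hn0 : n ≠ 0 := by rintro rfl; simp at hs
    have hxn : x n = ∑ j, if n j = 0 then 0 else g j (n - Pi.single j 1) := by
      rw [hx n, if_neg hn0, zero_add]
    have hcs := Finset.sum_sq_le_sum_mul_sum_of_sq_le_mul Finset.univ
      (r := fun j => ‖if n j = 0 then 0 else g j (n - Pi.single j 1)‖)
      (f := fun j => (n j : ℝ) / (N + 1) * wgt n)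
      (g := fun j => if n j = 0 then 0 else
        (wgt (n - Pi.single j 1))⁻¹ * ‖g j (n - Pi.single j 1)‖ ^ 2)
      (fun j _ => mul_nonneg (by positivity) (hw n).le)
      (fun j _ => by
        split_ifs
        · exact le_rfl
        · exact mul_nonneg (inv_nonneg.2 (hw _).le) (sq_nonneg _))
      (fun j _ => by
        by_cases h : n j = 0
        · simp [h]
        · have hp := wgt_add (n - Pi.single j 1) j
          have hsum := sum_add_single (n - Pi.single j 1) j
          rw [sub_add_single h] at hp hsum
          have e1 : ∑ i, (n - Pi.single j 1 : Fin d → ℕ) i = N := by omega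
          have e2 : (((n - Pi.single j 1 : Fin d → ℕ) j : ℕ) : ℝ) + 1 = n j := by
            have := congrFun (sub_add_single h) j
            simp only [Pi.add_apply, Pi.single_eq_same] at this
            exact_mod_cast this
          rw [e1, e2] at hp
          have hne := (hw (n - Pi.single j 1)).ne'
          simp only [if_neg h]
          have hN : ((N : ℝ) + 1) ≠ 0 := by positivity
          have e3 : (n j : ℝ) / (N + 1) * wgt n = wgt (n - Pi.single j 1) := by
            field_simp; linarith
          rw [e3]
          apply le_of_eq
          field_simp)
    have hf : ∑ j, (n j : ℝ) / (N + 1) * wgt n = wgt n := by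
      rw [← Finset.sum_mul, ← Finset.sum_div]
      have : ∑ j, (n j : ℝ) = N + 1 := by exact_mod_cast hs
      rw [this, div_self (by positivity), one_mul]
    rw [hf] at hcs
    rw [inv_mul_le_iff₀ (hw n)]
    refine le_trans ?_ hcs
    rw [hxn]
    gcongr
    exact norm_sum_le _ _
  refine (Finset.sum_le_sum h1).trans ?_
  rw [Finset.sum_comm]
  have h2 : ∀ j : Fin d, (∑ n ∈ Finset.piAntidiag (Finset.univ : Finset (Fin d)) (N + 1),
      if n j = 0 then 0 else (wgt (n - Pi.single j 1))⁻¹ * ‖g j (n - Pi.single j 1)‖ ^ 2)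
      = ∑ m ∈ Finset.piAntidiag (Finset.univ : Finset (Fin d)) N, (wgt m)⁻¹ * ‖g j m‖ ^ 2 := by
    intro j
    have : ∀ n : Fin d → ℕ, (if n j = 0 then 0 else
        (wgt (n - Pi.single j 1))⁻¹ * ‖g j (n - Pi.single j 1)‖ ^ 2)
        = if n j ≠ 0 then (wgt (n - Pi.single j 1))⁻¹ * ‖g j (n - Pi.single j 1)‖ ^ 2 else 0 := by
      intro n; by_cases h : n j = 0 <;> simp [h]
    simp_rw [this]
    rw [← Finset.sum_filter]
    refine Finset.sum_nbij' (fun n => n - Pi.single j 1) (fun m => m + Pi.single j 1)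
      ?_ ?_ ?_ ?_ ?_
    · intro n hn
      simp only [Finset.mem_filter, Finset.mem_piAntidiag] at hn
      have hsum := sum_add_single (n - Pi.single j 1) j
      rw [sub_add_single hn.2] at hsum
      simp only [Finset.mem_piAntidiag]
      exact ⟨Nat.succ_injective (hsum.symm.trans hn.1.1), by simp⟩
    · intro m hm
      simp only [Finset.mem_piAntidiag] at hm
      simp only [Finset.mem_filter, Finset.mem_piAntidiag]
      exact ⟨⟨(sum_add_single m j).trans (by rw [hm.1]), by simp⟩, by simp⟩
    · intro n hn
      simp only [Finset.mem_filter] at hn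
      exact sub_add_single hn.2
    · intro m _
      exact add_tsub_cancel_right _ _
    · intro n _; rfl
  simp_rw [h2]
  rw [Finset.sum_comm]
  refine Finset.sum_le_sum fun m _ => ?_
  rw [← Finset.mul_sum]
  exact mul_le_mul_of_nonneg_left (hg m) (inv_nonneg.2 (hw m).le)

lemma zpow_add_single {d : ℕ} (z : Fin d → ℂ) (m : Fin d → ℕ) (k : Fin d) :
    ∏ j, z j ^ (m + Pi.single k 1 : Fin d → ℕ) j = z k * ∏ j, z j ^ m j := by
  simp only [Pi.add_apply, pow_add, Finset.prod_mul_distrib]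
  rw [mul_comm]
  congr 1
  rw [Finset.prod_eq_single k]
  · simp
  · intro b _ hb; simp [hb]
  · simp

lemma hasSum_shift {d : ℕ} {X : Type*} [NormedAddCommGroup X] [NormedSpace ℂ X]
    (z : Fin d → ℂ) (k : Fin d) (g : (Fin d → ℕ) → X) (s : X)
    (h : HasSum (fun n : Fin d → ℕ => (∏ j, z j ^ n j) • g n) s) :
    HasSum (fun n : Fin d → ℕ => (∏ j, z j ^ n j) • (if n k = 0 then 0 else g (n - Pi.single k 1)))
      (z k • s) := by
  have hinj : Function.Injective fun m : Fin d → ℕ => m + Pi.single k 1 :=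
    add_left_injective _
  rw [← hinj.hasSum_iff]
  · have h2 := h.const_smul (z k)
    convert h2 using 2 with n
    simp only [Function.comp_apply]
    rw [zpow_add_single, mul_smul]
    simp
  · intro n hn
    have : n k = 0 := by
      by_contra h0
      exact hn ⟨n - Pi.single k 1, sub_add_single h0⟩
    simp [this]

lemma level_sum_le {d : ℕ} (f : (Fin d → ℕ) → ℝ) (hf : ∀ n, 0 ≤ f n) (hs : Summable f) (N : ℕ) :
    ∑ k ∈ Finset.range N, ∑ n ∈ Finset.piAntidiag (Finset.univ : Finset (Fin d)) k, f n
      ≤ ∑' n, f n := by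
  rw [← Finset.sum_biUnion]
  · exact hs.sum_le_tsum _ fun n _ => hf n
  · intro a _ b _ hab
    refine Finset.disjoint_left.2 fun n hn hn2 => hab ?_
    rw [← (Finset.mem_piAntidiag.1 hn).1, ← (Finset.mem_piAntidiag.1 hn2).1]

lemma norm_sum_smul_lt {d : ℕ} {X : Type*} [NormedAddCommGroup X] [NormedSpace ℂ X]
    (A : Fin d → X →L[ℂ] X) (h : ∀ ξ, ∑ j, ‖A j ξ‖ ^ 2 ≤ ‖ξ‖ ^ 2)
    (z : Fin d → ℂ) (hz : ∑ j, ‖z j‖ ^ 2 < 1) : ‖∑ k, z k • A k‖ < 1 := by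
  have hr0 : 0 ≤ ∑ j, ‖z j‖ ^ 2 := Finset.sum_nonneg fun j _ => by positivity
  have hs1 : √(∑ j, ‖z j‖ ^ 2) < 1 := by
    rw [Real.sqrt_lt' one_pos]; simpa using hz
  refine lt_of_le_of_lt (ContinuousLinearMap.opNorm_le_bound _ (Real.sqrt_nonneg _) fun ξ => ?_) hs1
  refine le_of_sq_le_sq ?_ (by positivity)
  have h1 : ‖(∑ k, z k • A k) ξ‖ ≤ ∑ k, ‖z k‖ * ‖A k ξ‖ := by
    rw [ContinuousLinearMap.sum_apply]
    refine (norm_sum_le _ _).trans (le_of_eq ?_)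
    refine Finset.sum_congr rfl fun k _ => ?_
    rw [ContinuousLinearMap.smul_apply, norm_smul]
  calc ‖(∑ k, z k • A k) ξ‖ ^ 2 ≤ (∑ k, ‖z k‖ * ‖A k ξ‖) ^ 2 := by gcongr
    _ ≤ (∑ k, ‖z k‖ ^ 2) * ∑ k, ‖A k ξ‖ ^ 2 := Finset.sum_mul_sq_le_sq_mul_sq _ _ _
    _ ≤ (∑ k, ‖z k‖ ^ 2) * ‖ξ‖ ^ 2 := mul_le_mul_of_nonneg_left (h ξ) hr0
    _ = _ := by rw [mul_pow, Real.sq_sqrt hr0]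

/-- Frequency-domain input/initial-state-to-output formula for a dissipative commutative
Fornasini-Marchesini system: for an input in `ℓ²_{U,ω}(ℤ₊^d)` and `z ∈ 𝔹^d` the
`Z`-transforms satisfy the frequency-domain equations, and
`ŷ(z) = F(z)û(z) + W(z)x(0)` with `F(z) = D + C(I−∑ z_kA_k)⁻¹(∑ z_kB_k)` and
`W(z) = C(I−∑ z_kA_k)⁻¹`. -/
theorem stmt_10 {d : ℕ} {X U Y : Type*}
    [NormedAddCommGroup X] [InnerProductSpace ℂ X] [CompleteSpace X]
    [NormedAddCommGroup U] [InnerProductSpace ℂ U] [CompleteSpace U]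
    [NormedAddCommGroup Y] [InnerProductSpace ℂ Y] [CompleteSpace Y]
    (A : Fin d → X →L[ℂ] X) (B : Fin d → U →L[ℂ] X)
    (C : X →L[ℂ] Y) (D : U →L[ℂ] Y)
    (hcontr : ∀ (ξ : X) (υ : U),
      (∑ j, ‖A j ξ + B j υ‖ ^ 2) + ‖C ξ + D υ‖ ^ 2 ≤ ‖ξ‖ ^ 2 + ‖υ‖ ^ 2)
    (x : (Fin d → ℤ) → X) (u : (Fin d → ℤ) → U) (y : (Fin d → ℕ) → Y)
    (hxzero : ∀ m : Fin d → ℤ, (∃ j, m j < 0) → x m = 0)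
    (huzero : ∀ m : Fin d → ℤ, (∃ j, m j < 0) → u m = 0)
    (hrec : ∀ n : Fin d → ℤ, (∀ j, 0 ≤ n j) → n ≠ 0 →
      x n = ∑ j, A j (x (n - Pi.single j 1)) + ∑ j, B j (u (n - Pi.single j 1)))
    (hy : ∀ n : Fin d → ℕ, y n = C (x fun j => (n j : ℤ)) + D (u fun j => (n j : ℤ)))
    -- the input sequence lies in `ℓ²_{U,ω}(ℤ₊^d)`:
    (hu : Summable fun n : Fin d → ℕ => wgt n * ‖u fun j => (n j : ℤ)‖ ^ 2)
    -- `z ∈ 𝔹^d`: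
    (z : Fin d → ℂ) (hz : ∑ j, ‖z j‖ ^ 2 < 1) :
    -- absolute convergence of the `Z`-transform series
    (Summable fun n : Fin d → ℕ => ‖(∏ j, z j ^ n j) • u fun j => (n j : ℤ)‖)
    ∧ (Summable fun n : Fin d → ℕ => ‖(∏ j, z j ^ n j) • x fun j => (n j : ℤ)‖)
    ∧ (Summable fun n : Fin d → ℕ => ‖(∏ j, z j ^ n j) • y n‖)
    -- frequency-domain state equation
    ∧ (∑' n : Fin d → ℕ, (∏ j, z j ^ n j) • x fun j => (n j : ℤ))
        = x 0
          + (∑ k, z k • A k) (∑' n : Fin d → ℕ, (∏ j, z j ^ n j) • x fun j => (n j : ℤ))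
          + (∑ k, z k • B k) (∑' n : Fin d → ℕ, (∏ j, z j ^ n j) • u fun j => (n j : ℤ))
    -- frequency-domain output equation
    ∧ (∑' n : Fin d → ℕ, (∏ j, z j ^ n j) • y n)
        = C (∑' n : Fin d → ℕ, (∏ j, z j ^ n j) • x fun j => (n j : ℤ))
          + D (∑' n : Fin d → ℕ, (∏ j, z j ^ n j) • u fun j => (n j : ℤ))
    -- invertibility of `I − ∑_k z_k A_k`
    ∧ IsUnit ((1 : X →L[ℂ] X) - ∑ k, z k • A k)
    -- `ŷ(z) = F(z) û(z) + W(z) x(0)`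
    ∧ (∑' n : Fin d → ℕ, (∏ j, z j ^ n j) • y n)
        = (D + C.comp ((Ring.inverse ((1 : X →L[ℂ] X) - ∑ k, z k • A k)).comp
              (∑ k, z k • B k)))
            (∑' n : Fin d → ℕ, (∏ j, z j ^ n j) • u fun j => (n j : ℤ))
          + (C.comp (Ring.inverse ((1 : X →L[ℂ] X) - ∑ k, z k • A k))) (x 0) := by
  have hw : ∀ n : Fin d → ℕ, 0 < wgt n := fun n => one_pos.trans_le (one_le_wgt n)
  obtain ⟨xx, hxx⟩ : ∃ xx : (Fin d → ℕ) → X, xx = fun n => x fun j => (n j : ℤ) := ⟨_, rfl⟩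
  obtain ⟨uu, huu⟩ : ∃ uu : (Fin d → ℕ) → U, uu = fun n => u fun j => (n j : ℤ) := ⟨_, rfl⟩
  have hxx' : ∀ n : Fin d → ℕ, (x fun j => (n j : ℤ)) = xx n := fun n => by rw [hxx]
  have huu' : ∀ n : Fin d → ℕ, (u fun j => (n j : ℤ)) = uu n := fun n => by rw [huu]
  have hcast : ∀ (n : Fin d → ℕ) (j : Fin d), n j ≠ 0 →
      (fun i => (n i : ℤ)) - Pi.single j 1 = fun i => ((n - Pi.single j 1 : Fin d → ℕ) i : ℤ) := by
    intro n j h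
    funext i
    by_cases hi : i = j
    · subst hi; simp; omega
    · simp [hi]
  have hrec' : ∀ n, xx n = (if n = 0 then x 0 else 0)
      + ∑ j, if n j = 0 then 0 else (A j (xx (n - Pi.single j 1)) + B j (uu (n - Pi.single j 1))) := by
    intro n
    by_cases h0 : n = 0
    · subst h0
      rw [hxx]
      simp only [Pi.zero_apply, if_true, Finset.sum_const_zero, add_zero, Nat.cast_zero]
      rfl
    · rw [if_neg h0, zero_add, ← hxx' n, hrec _ (fun j => by simp) (fun h => h0 ?_),
        ← Finset.sum_add_distrib]
      · refine Finset.sum_congr rfl fun j _ => ?_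
        by_cases hj : n j = 0
        · have hneg : ∃ i, ((fun i => (n i : ℤ)) - Pi.single j 1 : Fin d → ℤ) i < 0 := ⟨j, by simp [hj]⟩
          rw [hxzero _ hneg, huzero _ hneg, if_pos hj]
          simp
        · rw [if_neg hj, hcast n j hj, hxx', huu']
      · funext i
        have := congrFun h i
        simpa using this
  simp only [hxx', huu'] at hy hu ⊢
  -- level bounds
  have hcon : ∀ m, ∑ j, ‖A j (xx m) + B j (uu m)‖ ^ 2 ≤ ‖xx m‖ ^ 2 + ‖uu m‖ ^ 2 := fun m => by
    have := hcontr (xx m) (uu m)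
    have h2 := sq_nonneg ‖C (xx m) + D (uu m)‖
    linarith
  have hfu0 : ∀ n, 0 ≤ (wgt n)⁻¹ * ‖uu n‖ ^ 2 := fun n =>
    mul_nonneg (inv_nonneg.2 (hw n).le) (sq_nonneg _)
  have hfu : Summable fun n => (wgt n)⁻¹ * ‖uu n‖ ^ 2 := by
    refine Summable.of_nonneg_of_le hfu0 (fun n => ?_) hu
    refine mul_le_mul_of_nonneg_right ?_ (sq_nonneg _)
    exact (inv_le_one_of_one_le₀ (one_le_wgt n)).trans (one_le_wgt n)
  have hK := level_sum_le _ hfu0 hfu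
  have hSu := level_summable z hz (fun n => ‖uu n‖) (fun n => norm_nonneg _) _ (fun N =>
    (hfu.sum_le_tsum _ fun n _ => hfu0 n))
  have hE : ∀ N, ∑ n ∈ Finset.piAntidiag (Finset.univ : Finset (Fin d)) N,
      (wgt n)⁻¹ * ‖xx n‖ ^ 2 ≤
      ∑ n ∈ Finset.piAntidiag (Finset.univ : Finset (Fin d)) 0, (wgt n)⁻¹ * ‖xx n‖ ^ 2
      + ∑ k ∈ Finset.range N, ∑ n ∈ Finset.piAntidiag (Finset.univ : Finset (Fin d)) k,
        (wgt n)⁻¹ * ‖uu n‖ ^ 2 := by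
    intro N
    induction N with
    | zero => simp
    | succ N ih =>
      have := level_step xx (fun j m => A j (xx m) + B j (uu m)) (x 0)
        (fun m => ‖xx m‖ ^ 2 + ‖uu m‖ ^ 2) hcon hrec' N
      simp only [mul_add, Finset.sum_add_distrib] at this
      rw [Finset.sum_range_succ]
      linarith
  have hSx := level_summable z hz (fun n => ‖xx n‖) (fun n => norm_nonneg _) _ (fun N =>
    (hE N).trans (add_le_add_right (hK N) _))
  have hSu' : Summable fun n : Fin d → ℕ => ‖(∏ j, z j ^ n j) • uu n‖ := by
    simpa only [norm_smul] using hSu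
  have hSx' : Summable fun n : Fin d → ℕ => ‖(∏ j, z j ^ n j) • xx n‖ := by
    simpa only [norm_smul] using hSx
  have hU := hSu'.of_norm.hasSum
  have hX := hSx'.of_norm.hasSum
  set Us := ∑' n : Fin d → ℕ, (∏ j, z j ^ n j) • uu n
  set Xs := ∑' n : Fin d → ℕ, (∏ j, z j ^ n j) • xx n
  have hYeq : (fun n : Fin d → ℕ => (∏ j, z j ^ n j) • y n) = fun n =>
      C ((∏ j, z j ^ n j) • xx n) + D ((∏ j, z j ^ n j) • uu n) := by
    funext n
    rw [hy, smul_add, map_smul, map_smul]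
  have hY : HasSum (fun n : Fin d → ℕ => (∏ j, z j ^ n j) • y n) (C Xs + D Us) := by
    rw [hYeq]
    exact (C.hasSum hX).add (D.hasSum hU)
  have hSy' : Summable fun n : Fin d → ℕ => ‖(∏ j, z j ^ n j) • y n‖ := by
    refine Summable.of_nonneg_of_le (fun n => norm_nonneg _) (fun n => ?_)
      ((hSx'.mul_left ‖C‖).add (hSu'.mul_left ‖D‖))
    rw [congrFun hYeq n]
    exact (norm_add_le _ _).trans (add_le_add (C.le_opNorm _) (D.le_opNorm _))
  have hstate : Xs = x 0 + (∑ k, z k • A k) Xs + (∑ k, z k • B k) Us := by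
    have h0 : HasSum (fun n : Fin d → ℕ => (∏ j, z j ^ n j) • (if n = 0 then x 0 else 0)) (x 0) := by
      have := hasSum_single (f := fun n : Fin d → ℕ =>
        (∏ j, z j ^ n j) • (if n = 0 then x 0 else 0)) 0 (fun n hn => by simp [hn])
      simpa using this
    have hk : ∀ k, HasSum (fun n : Fin d → ℕ => (∏ j, z j ^ n j) • (if n k = 0 then 0 else
        (A k (xx (n - Pi.single k 1)) + B k (uu (n - Pi.single k 1)))))
        (z k • (A k Xs + B k Us)) := by
      intro k
      refine hasSum_shift z k (fun m => A k (xx m) + B k (uu m)) _ ?_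
      have := ((A k).hasSum hX).add ((B k).hasSum hU)
      simpa only [smul_add, map_smul] using this
    have htot := h0.add (hasSum_sum (s := Finset.univ) fun k _ => hk k)
    have hfun : (fun n : Fin d → ℕ => (∏ j, z j ^ n j) • xx n) = fun n =>
        (∏ j, z j ^ n j) • (if n = 0 then x 0 else 0) + ∑ k, (∏ j, z j ^ n j) •
          (if n k = 0 then 0 else
        (A k (xx (n - Pi.single k 1)) + B k (uu (n - Pi.single k 1)))) := by
      funext n
      rw [← Finset.smul_sum, ← smul_add, ← hrec' n]
    rw [← hfun] at htot
    rw [hX.unique htot]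
    have e1 : (∑ k, z k • (A k Xs + B k Us))
        = (∑ k, z k • A k) Xs + (∑ k, z k • B k) Us := by
      simp [ContinuousLinearMap.sum_apply, Finset.sum_add_distrib]
    rw [← hX.unique htot, add_assoc, ← e1]
    exact hX.unique htot
  have hunit : IsUnit ((1 : X →L[ℂ] X) - ∑ k, z k • A k) := by
    refine isUnit_one_sub_of_norm_lt_one (norm_sum_smul_lt A (fun ξ => ?_) z hz)
    have := hcontr ξ 0
    simp only [map_zero, add_zero, norm_zero] at this
    have h2 := sq_nonneg ‖C ξ‖
    linarith
  refine ⟨hSu', hSx', hSy', hstate, hY.tsum_eq, hunit, ?_⟩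
  rw [hY.tsum_eq]
  have hsol : Xs = Ring.inverse ((1 : X →L[ℂ] X) - ∑ k, z k • A k)
      ((∑ k, z k • B k) Us + x 0) := by
    have h1 : ((1 : X →L[ℂ] X) - ∑ k, z k • A k) Xs = (∑ k, z k • B k) Us + x 0 := by
      rw [ContinuousLinearMap.sub_apply, ContinuousLinearMap.one_apply, sub_eq_iff_eq_add]
      calc Xs = _ := hstate
        _ = _ := by abel
    rw [← h1, ← ContinuousLinearMap.mul_apply, Ring.inverse_mul_cancel _ hunit,
      ContinuousLinearMap.one_apply]
  rw [map_add] at hsol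
  simp only [ContinuousLinearMap.add_apply, ContinuousLinearMap.comp_apply]
  rw [add_assoc, ← map_add C, ← hsol, add_comm]
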